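/- arXiv:1709.00446 — 2 statements merged into one kernel-verified Lean document; each statement's English description precedes it below -/
import Mathlib

section
/- Let f be an nc self-map of 𝔅_d with f₁(0) = 0, and let X ∈ 𝔅_d(n) be a fixed point of f_n. Let A = Df_n(X) be the Fréchet derivative of f_n at X, a ℂ-linear endomorphism of M_n(ℂ)^d. Then the geometric and algebraic multiplicities of 1 as an eigenvalue of A coincide; equivalently, ker((A − id)²) = ker(A − id). -/
open Matrix
open scoped ComplexOrder

attribute [local instance] Matrix.normedAddCommGroup Matrix.normedSpace

/-- The space of `d`-tuples of `n × n` complex matrices. -/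
abbrev MatTuple (d n : ℕ) := Fin d → Matrix (Fin n) (Fin n) ℂ

/-- The free matrix ball at level `n`: strict row contractions. -/
def freeBall (d n : ℕ) : Set (MatTuple d n) :=
  {X | (1 - ∑ j, X j * (X j)ᴴ).PosDef}

/-- The direct sum of two tuples of matrices. -/
def dSum {d n m : ℕ} (X : MatTuple d n) (Y : MatTuple d m) : MatTuple d (n + m) :=
  fun j => Matrix.reindex finSumFinEquiv finSumFinEquiv (Matrix.fromBlocks (X j) 0 0 (Y j))

/-- An nc self-map of the free ball `𝔅_d`. -/
structure NCSelfMap (d : ℕ) where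
  app : ∀ n, MatTuple d n → MatTuple d n
  mapsTo : ∀ n, Set.MapsTo (app n) (freeBall d n) (freeBall d n)
  map_dSum : ∀ {n m : ℕ} (X : MatTuple d n) (Y : MatTuple d m),
    X ∈ freeBall d n → Y ∈ freeBall d m →
    app (n + m) (dSum X Y) = dSum (app n X) (app m Y)
  map_sim : ∀ {n : ℕ} (X : MatTuple d n) (S : Matrix (Fin n) (Fin n) ℂ),
    X ∈ freeBall d n → IsUnit S →
    (fun j => S⁻¹ * X j * S) ∈ freeBall d n →
    app n (fun j => S⁻¹ * X j * S) = fun j => S⁻¹ * app n X j * S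
  holo : ∀ n, DifferentiableOn ℂ (app n) (freeBall d n)

/-- A tuple is generic if its coordinates generate the full matrix algebra. -/
def IsGeneric {d n : ℕ} (X : MatTuple d n) : Prop :=
  Algebra.adjoin ℂ (Set.range X) = ⊤

/-- The homogeneous degree-one linear relations satisfied by the coordinates of `X`. -/
def linRel {d n : ℕ} (X : MatTuple d n) : Set (Fin d → ℂ) :=
  {α | ∑ j, α j • X j = 0}

/-- The scalar point of level `n` associated to a vector in `ℂ^d`. -/
def scalarPt (d n : ℕ) (v : Fin d → ℂ) : MatTuple d n :=
  fun j => v j • (1 : Matrix (Fin n) (Fin n) ℂ)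

section BoundedDomain

variable {E : Type*} [NormedAddCommGroup E] [NormedSpace ℂ E]

/-- The derivative of a holomorphic self-map of a bounded open set at a fixed point is
power bounded on each vector. -/
theorem exists_norm_fderiv_pow_apply_le {U : Set E} (hU : IsOpen U) {C : ℝ}
    (hC : ∀ x ∈ U, ‖x‖ ≤ C) {g : E → E} (hmaps : Set.MapsTo g U U)
    (hg : DifferentiableOn ℂ g U) {x : E} (hx : x ∈ U) (hfix : g x = x) (v : E) :
    ∃ K : ℝ, ∀ k : ℕ, ‖(fderiv ℂ g x ^ k) v‖ ≤ K := by
  have hline : Continuous fun z : ℂ => x + z • v := by fun_prop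
  have hmem : (fun z : ℂ => x + z • v) ⁻¹' U ∈ nhds (0 : ℂ) :=
    hline.continuousAt.preimage_mem_nhds (hU.mem_nhds (by simpa using hx))
  obtain ⟨R, hR, hball⟩ := Metric.nhds_basis_closedBall.mem_iff.1 hmem
  refine ⟨C / R, fun k => ?_⟩
  have hgk : DifferentiableOn ℂ g^[k] U := hg.iterate hmaps k
  have hcomp : DifferentiableOn ℂ (fun z : ℂ => g^[k] (x + z • v)) (Metric.closedBall 0 R) :=
    hgk.comp (by fun_prop) hball
  have hderiv : HasDerivAt (fun z : ℂ => g^[k] (x + z • v)) ((fderiv ℂ g x ^ k) v) 0 := by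
    have h := (((hg.differentiableAt (hU.mem_nhds hx)).hasFDerivAt).iterate hfix k)
    have hl : HasDerivAt (fun z : ℂ => x + z • v) v 0 := by
      simpa using ((hasDerivAt_id (0 : ℂ)).smul_const v).const_add x
    exact HasFDerivAt.comp_hasDerivAt (0 : ℂ) (by simpa using h) hl
  rw [← hderiv.deriv]
  refine Complex.norm_deriv_le_of_forall_mem_sphere_norm_le hR ?_ fun z hz => ?_
  · exact DifferentiableOn.diffContOnCl (hcomp.mono Metric.closure_ball_subset_closedBall)
  · exact hC _ (hmaps.iterate k (hball (Metric.sphere_subset_closedBall hz)))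

/-- A linear operator with bounded orbits has no nontrivial Jordan block for the eigenvalue `1`. -/
theorem ker_sub_id_comp_self_of_bounded_orbits (A : E →L[ℂ] E)
    (hA : ∀ v, ∃ K : ℝ, ∀ k : ℕ, ‖(A ^ k) v‖ ≤ K) :
    LinearMap.ker ((A.toLinearMap - LinearMap.id) ∘ₗ (A.toLinearMap - LinearMap.id)) =
      LinearMap.ker (A.toLinearMap - LinearMap.id) := by
  refine le_antisymm (fun v hv => ?_) (LinearMap.ker_le_ker_comp _ _)
  obtain ⟨w, hw⟩ : ∃ w, w = A v - v := ⟨_, rfl⟩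
  have hAw : A w = w := by
    have h : A (A v - v) - (A v - v) = 0 := hv
    rw [hw]
    exact sub_eq_zero.1 h
  have hAv : A v = v + w := by rw [hw]; abel
  have hpow : ∀ k : ℕ, (A ^ k) v = v + (k : ℂ) • w := by
    intro k
    induction k with
    | zero => simp
    | succ k ih =>
      rw [pow_succ', mul_apply_eq_comp, ih, map_add, map_smul, hAw, hAv]
      push_cast
      rw [add_smul, one_smul]
      abel
  obtain ⟨K, hK⟩ := hA v
  have hw0 : w = 0 := by
    by_contra hne
    obtain ⟨k, hk⟩ := exists_nat_gt ((K + ‖v‖) / ‖w‖)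
    rw [div_lt_iff₀ (norm_pos_iff.2 hne)] at hk
    have h1 : ‖(k : ℂ) • w‖ ≤ ‖v + (k : ℂ) • w‖ + ‖v‖ := by
      simpa using norm_sub_le (v + (k : ℂ) • w) v
    have h2 := hK k
    rw [hpow] at h2
    rw [norm_smul, Complex.norm_natCast] at h1
    linarith
  rw [LinearMap.mem_ker]
  exact hw.symm.trans hw0

end BoundedDomain

theorem isHermitian_one_sub_sum_mul_conjTranspose {d n : ℕ} (X : MatTuple d n) :
    (1 - ∑ j, X j * (X j)ᴴ).IsHermitian := by
  simp [Matrix.IsHermitian, Matrix.conjTranspose_sum]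

/-- Positive definiteness can be tested on the compact unit sphere. -/
theorem Matrix.IsHermitian.posDef_iff_forall_sphere {n : ℕ} {M : Matrix (Fin n) (Fin n) ℂ}
    (hM : M.IsHermitian) :
    M.PosDef ↔ ∀ v ∈ Metric.sphere (0 : Fin n → ℂ) 1, 0 < (star v ⬝ᵥ (M *ᵥ v)).re := by
  have him : ∀ v : Fin n → ℂ, (star v ⬝ᵥ (M *ᵥ v)).im = 0 := fun v =>
    hM.im_star_dotProduct_mulVec_self v
  rw [Matrix.posDef_iff_dotProduct_mulVec]
  refine ⟨fun h v hv => ?_, fun h => ⟨hM, fun v hv => ?_⟩⟩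
  · exact (Complex.pos_iff.1 (h.2 (ne_zero_of_mem_unit_sphere ⟨v, hv⟩))).1
  · have hpos : 0 < ‖v‖ := norm_pos_iff.2 hv
    have hu := h (((‖v‖⁻¹ : ℝ) : ℂ) • v) (by
      simp [norm_smul, hpos.ne'])
    rw [star_smul, Matrix.mulVec_smul, smul_dotProduct, dotProduct_smul, smul_eq_mul, smul_eq_mul,
      Complex.star_def, Complex.conj_ofReal, Complex.re_ofReal_mul, Complex.re_ofReal_mul] at hu
    refine Complex.pos_iff.2 ⟨?_, (him v).symm⟩
    have hinv : 0 < ‖v‖⁻¹ := inv_pos.2 hpos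
    exact pos_of_mul_pos_right (pos_of_mul_pos_right hu hinv.le) hinv.le

theorem isOpen_freeBall (d n : ℕ) : IsOpen (freeBall d n) := by
  have heq : freeBall d n = {X : MatTuple d n | ∀ v ∈ Metric.sphere (0 : Fin n → ℂ) 1,
      0 < (star v ⬝ᵥ ((1 - ∑ j, X j * (X j)ᴴ) *ᵥ v)).re} := by
    ext X
    exact (isHermitian_one_sub_sum_mul_conjTranspose X).posDef_iff_forall_sphere
  rw [heq, isOpen_iff_eventually]
  intro X hX
  refine (isCompact_sphere (0 : Fin n → ℂ) 1).eventually_forall_of_forall_eventually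
    fun v hv => ?_
  have hcont : Continuous fun p : MatTuple d n × (Fin n → ℂ) =>
      (star p.2 ⬝ᵥ ((1 - ∑ j, p.1 j * (p.1 j)ᴴ) *ᵥ p.2)).re := by
    fun_prop
  exact hcont.continuousAt.eventually (lt_mem_nhds (hX v hv))

theorem norm_le_one_of_mem_freeBall {d n : ℕ} {X : MatTuple d n} (hX : X ∈ freeBall d n) :
    ‖X‖ ≤ 1 := by
  refine (pi_norm_le_iff_of_nonneg zero_le_one).2 fun j =>
    (Matrix.norm_le_iff zero_le_one).2 fun i k => ?_
  have hdiag : 0 < (1 - ∑ j, X j * (X j)ᴴ) i i := Matrix.PosDef.diag_pos hX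
  have hre := (Complex.pos_iff.1 hdiag).1
  simp only [Matrix.sub_apply, Matrix.one_apply_eq, Matrix.sum_apply, Matrix.mul_apply,
    Matrix.conjTranspose_apply, Complex.star_def, Complex.mul_conj, Complex.sub_re, Complex.one_re,
    Complex.re_sum, Complex.ofReal_re, Complex.normSq_eq_norm_sq] at hre
  have h1 : ‖X j i k‖ ^ 2 ≤ ∑ l, ‖X j i l‖ ^ 2 :=
    Finset.single_le_sum (f := fun l => ‖X j i l‖ ^ 2) (fun _ _ => sq_nonneg _)
      (Finset.mem_univ k)
  have h2 : ∑ l, ‖X j i l‖ ^ 2 ≤ ∑ j, ∑ l, ‖X j i l‖ ^ 2 :=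
    Finset.single_le_sum (f := fun j => ∑ l, ‖X j i l‖ ^ 2)
      (fun _ _ => Finset.sum_nonneg fun _ _ => sq_nonneg _) (Finset.mem_univ j)
  exact (sq_le_one_iff₀ (norm_nonneg _)).1 (by linarith)

/-- at a fixed point of an nc self-map fixing the origin, the derivative has
no nontrivial Jordan block for the eigenvalue `1`: `ker((A - id)²) = ker(A - id)`. -/
theorem stmt_8 {d n : ℕ} (f : NCSelfMap d) (hf0 : f.app 1 0 = 0)
    (X : MatTuple d n) (hX : X ∈ freeBall d n) (hfix : f.app n X = X) :
    LinearMap.ker (((fderiv ℂ (f.app n) X).toLinearMap - LinearMap.id) ∘ₗ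
        ((fderiv ℂ (f.app n) X).toLinearMap - LinearMap.id)) =
      LinearMap.ker ((fderiv ℂ (f.app n) X).toLinearMap - LinearMap.id) := by
  exact ker_sub_id_comp_self_of_bounded_orbits _
    (exists_norm_fderiv_pow_apply_le (isOpen_freeBall d n)
      (fun _ => norm_le_one_of_mem_freeBall) (f.mapsTo n) (f.holo n) hX hfix)
end

section
/- Let f be an nc self-map of 𝔅_d such that the only fixed point of f₁ in 𝔅_d(1) is the origin 0. Then for every n ≥ 1, the only fixed point of f_n in 𝔅_d(n) is the zero tuple 0 = (0,…,0). -/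
open Matrix
open scoped ComplexOrder

attribute [local instance] Matrix.normedAddCommGroup Matrix.normedSpace

section Schwarz

open Metric

variable {E F : Type*} [NormedAddCommGroup E] [NormedSpace ℂ E]
  [NormedAddCommGroup F] [NormedSpace ℂ F]

/-- A holomorphic self-map of `{x | ‖R x‖ < 1}` fixing `0`, restricted to a complex line through
`0` and composed with a contraction, satisfies the hypotheses of the Schwarz lemma. -/
theorem schwarz_slice {G : Type*} [NormedAddCommGroup G] [NormedSpace ℂ G]
    (R : E →L[ℂ] F) {f : E → E} {T : E →L[ℂ] E}
    (hf : DifferentiableOn ℂ f {x | ‖R x‖ < 1})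
    (hm : Set.MapsTo f {x | ‖R x‖ < 1} {x | ‖R x‖ < 1}) (h0 : f 0 = 0)
    (hT : HasFDerivAt f T 0) {u : E} (hu : ‖R u‖ = 1) (φ : F →L[ℂ] G) (hφ : ‖φ‖ ≤ 1) :
    DifferentiableOn ℂ (fun z : ℂ => φ (R (f (z • u)))) (ball 0 1) ∧
    Set.MapsTo (fun z : ℂ => φ (R (f (z • u)))) (ball 0 1)
      (closedBall (φ (R (f ((0 : ℂ) • u)))) 1) ∧
    HasDerivAt (fun z : ℂ => φ (R (f (z • u)))) (φ (R (T u))) 0 := by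
  have hz : Set.MapsTo (fun z : ℂ => z • u) (ball 0 1) {x | ‖R x‖ < 1} := by
    intro z hz
    simpa [norm_smul, hu] using hz
  refine ⟨?_, ?_, ?_⟩
  · exact (φ.comp R).differentiable.comp_differentiableOn
      (hf.comp (by fun_prop) hz)
  · intro z hz'
    have h1 : ‖R (f (z • u))‖ < 1 := hm (hz hz')
    simp only [zero_smul, h0, map_zero, mem_closedBall_zero_iff]
    exact (φ.le_of_opNorm_le hφ _).trans (by linarith)
  · have hline : HasDerivAt (fun z : ℂ => z • u) u 0 := by
      simpa using (hasDerivAt_id (0 : ℂ)).smul_const u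
    have hT' : HasFDerivAt f T ((0 : ℂ) • u) := by simpa using hT
    exact (φ.comp R).hasFDerivAt.comp_hasDerivAt (0 : ℂ) (hT'.comp_hasDerivAt (0 : ℂ) hline)

/-- If a holomorphic self-map of a ball fixes the centre and another point, then its derivative
at the centre has a nonzero fixed vector. -/
theorem exists_fixed_vector_of_fixed_point [FiniteDimensional ℂ E]
    (R : E →L[ℂ] F) (hR : Function.Injective R) {f : E → E} {T : E →L[ℂ] E}
    (hf : DifferentiableOn ℂ f {x | ‖R x‖ < 1})
    (hm : Set.MapsTo f {x | ‖R x‖ < 1} {x | ‖R x‖ < 1}) (h0 : f 0 = 0)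
    (hT : HasFDerivAt f T 0) {x : E} (hx : ‖R x‖ < 1) (hx0 : x ≠ 0) (hfx : f x = x) :
    ∃ w, w ≠ 0 ∧ T w = w := by
  by_contra! hcon
  have hRx : 0 < ‖R x‖ := norm_pos_iff.2 fun h => hx0 (hR (by simpa using h))
  obtain ⟨φ, hφ, hφx⟩ := exists_dual_vector ℂ (R x) hRx.ne'
  have hfk (k : ℕ) : DifferentiableOn ℂ f^[k] {x | ‖R x‖ < 1} := hf.iterate hm k
  have hmk (k : ℕ) : Set.MapsTo f^[k] {x | ‖R x‖ < 1} {x | ‖R x‖ < 1} := hm.iterate k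
  have h0k (k : ℕ) : f^[k] 0 = 0 := Function.iterate_fixed h0 k
  have hTk (k : ℕ) : HasFDerivAt f^[k] (T ^ k) 0 := hT.iterate h0 k
  have hbound (k : ℕ) (w : E) : ‖φ (R ((T ^ k) w))‖ ≤ ‖R w‖ := by
    by_cases hw : w = 0
    · simp [hw]
    have hRw : 0 < ‖R w‖ := norm_pos_iff.2 fun h => hw (hR (by simpa using h))
    obtain ⟨h1, h2, h3⟩ := schwarz_slice R (hfk k) (hmk k) (h0k k) (hTk k)
      (u := ((‖R w‖ : ℂ)⁻¹) • w) (by simp [norm_smul, hRw.ne']) φ hφ.le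
    have := Complex.norm_deriv_le_one_of_mapsTo_ball h1 h2 one_pos
    rw [h3.deriv] at this
    simp only [map_smul, norm_smul, norm_inv, Complex.norm_real, norm_norm] at this
    rwa [inv_mul_le_iff₀ hRw, mul_one] at this
  have hval (k : ℕ) : φ (R ((T ^ k) x)) = ‖R x‖ := by
    have hrC : (‖R x‖ : ℂ) ≠ 0 := by exact_mod_cast hRx.ne'
    obtain ⟨h1, h2, h3⟩ := schwarz_slice R (hfk k) (hmk k) (h0k k) (hTk k)
      (u := ((‖R x‖ : ℂ)⁻¹) • x) (by simp [norm_smul, hRx.ne']) φ hφ.le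
    set g : ℂ → ℂ := fun z : ℂ => φ (R (f^[k] (z • ((‖R x‖ : ℂ)⁻¹) • x))) with hg
    have hg0 : g 0 = 0 := by simp [hg, h0k]
    have hgr : g ‖R x‖ = ‖R x‖ := by
      simp [hg, smul_smul, hrC, Function.iterate_fixed hfx, hφx]
    have hds : dslope g 0 (‖R x‖ : ℂ) = 1 := by
      rw [dslope_of_ne _ hrC, slope_def_field, hg0, hgr]
      simp [hrC]
    have hmem : (‖R x‖ : ℂ) ∈ ball (0 : ℂ) 1 := by simpa using hx
    have haff := Complex.affine_of_mapsTo_ball_of_norm_dslope_eq_div h1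
      (by simpa [hg] using h2) hmem (by rw [hds]; simp)
    have hev : g =ᶠ[nhds 0] fun z => z := by
      filter_upwards [ball_mem_nhds (0 : ℂ) one_pos] with z hz
      simpa [hds, hg0] using haff hz
    have hd := (h3.congr_of_eventuallyEq hev.symm).unique (hasDerivAt_id (0 : ℂ))
    simp only [map_smul, smul_eq_mul] at hd
    field_simp at hd
    exact hd
  have hinj : Function.Injective (T - 1 : E →L[ℂ] E).toLinearMap := by
    rw [injective_iff_map_eq_zero]
    intro w hw
    by_contra hw0
    exact hcon w hw0 (sub_eq_zero.1 (by simpa using hw))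
  obtain ⟨w, hw⟩ := LinearMap.injective_iff_surjective.1 hinj x
  have hw' : T w - w = x := by simpa using hw
  have htel (k : ℕ) : φ (R ((T ^ k) w)) = φ (R w) + k * ‖R x‖ := by
    induction k with
    | zero => simp
    | succ k ih =>
      have : (T ^ (k + 1)) w = (T ^ k) w + (T ^ k) x := by
        rw [← hw', map_sub, pow_succ]
        simp
      rw [this, map_add, map_add, ih, hval]
      push_cast
      ring
  obtain ⟨k, hk⟩ := exists_nat_gt ((‖R w‖ + ‖R w‖) / ‖R x‖)
  rw [div_lt_iff₀ hRx] at hk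
  have h1 := hbound k w
  have h2 := hbound 0 w
  simp only [pow_zero, one_apply_eq_self] at h2
  have h3 : (k : ℂ) * ‖R x‖ = φ (R ((T ^ k) w)) - φ (R w) := by rw [htel]; ring
  have h4 := congrArg norm h3
  rw [norm_mul, Complex.norm_natCast, Complex.norm_real, norm_norm] at h4
  linarith [norm_sub_le (φ (R ((T ^ k) w))) (φ (R w))]

/-- If the unit ball is strictly convex and the derivative at the centre of a holomorphic self-map
fixing the centre has a nonzero fixed vector, then the map has another fixed point. -/
theorem exists_fixed_point_of_fixed_vector [StrictConvexSpace ℝ F]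
    (R : E →L[ℂ] F) (hR : Function.Injective R) {f : E → E} {T : E →L[ℂ] E}
    (hf : DifferentiableOn ℂ f {x | ‖R x‖ < 1})
    (hm : Set.MapsTo f {x | ‖R x‖ < 1} {x | ‖R x‖ < 1}) (h0 : f 0 = 0)
    (hT : HasFDerivAt f T 0) {w : E} (hw0 : w ≠ 0) (hw : T w = w) :
    ∃ x, ‖R x‖ < 1 ∧ x ≠ 0 ∧ f x = x := by
  have hRw : 0 < ‖R w‖ := norm_pos_iff.2 fun h => hw0 (hR (by simpa using h))
  have hrC : (‖R w‖ : ℂ) ≠ 0 := by exact_mod_cast hRw.ne'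
  set u : E := ((‖R w‖ : ℂ)⁻¹) • w with hu
  have hu1 : ‖R u‖ = 1 := by simp [hu, norm_smul, hRw.ne']
  obtain ⟨h1, h2, h3⟩ := schwarz_slice R hf hm h0 hT hu1 (ContinuousLinearMap.id ℂ F)
    ContinuousLinearMap.norm_id_le
  have hTu : T u = u := by simp [hu, hw]
  have hds : dslope (fun z : ℂ => ContinuousLinearMap.id ℂ F (R (f (z • u)))) 0 0 = R u := by
    rw [dslope_same, h3.deriv, hTu]; rfl
  have haff := Complex.affine_of_mapsTo_ball_of_norm_dslope_eq_div h1 h2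
    (mem_ball_self one_pos) (by rw [hds, hu1]; simp)
  have hhalf : (1 / 2 : ℂ) ∈ ball (0 : ℂ) 1 := by norm_num
  have := haff hhalf
  rw [hds] at this
  refine ⟨(1 / 2 : ℂ) • u, ?_, ?_, hR ?_⟩
  · rw [map_smul, norm_smul, hu1]; norm_num
  · exact smul_ne_zero (by norm_num) (smul_ne_zero (inv_ne_zero hrC) hw0)
  · simpa [h0] using this

/-- Derivatives at `0` of maps intertwined by a linear map `A` are intertwined by `A`. -/
theorem HasFDerivAt.intertwine {f : E → E} {g : F → F} {T : E →L[ℂ] E} {T' : F →L[ℂ] F}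
    (A : E →L[ℂ] F) (hf : HasFDerivAt f T 0) (hg : HasFDerivAt g T' 0)
    (h : ∀ᶠ x in nhds 0, g (A x) = A (f x)) (w : E) : T' (A w) = A (T w) := by
  have hg' : HasFDerivAt g T' (A 0) := by simpa using hg
  have h1 := hg'.comp (0 : E) A.hasFDerivAt
  have h2 := A.hasFDerivAt.comp (0 : E) hf
  exact DFunLike.congr_fun ((h1.congr_of_eventuallyEq
    (h.mono fun x hx => hx.symm)).unique h2) w

theorem ContinuousLinearMap.norm_lt_one_iff_forall [FiniteDimensional ℂ E] (T : E →L[ℂ] F) :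
    ‖T‖ < 1 ↔ ∀ x, x ≠ 0 → ‖T x‖ < ‖x‖ := by
  constructor
  · intro h x hx
    calc ‖T x‖ ≤ ‖T‖ * ‖x‖ := T.le_opNorm x
      _ < 1 * ‖x‖ := mul_lt_mul_of_pos_right h (norm_pos_iff.2 hx)
      _ = ‖x‖ := one_mul _
  · intro h
    rcases subsingleton_or_nontrivial E with hE | hE
    · simp [Subsingleton.elim T 0]
    have : ProperSpace E := FiniteDimensional.proper ℂ E
    obtain ⟨v, hv⟩ := exists_norm_eq E (zero_le_one' ℝ)
    obtain ⟨x, hx, hmax⟩ := (isCompact_sphere (0 : E) 1).exists_isMaxOn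
      ⟨v, by simpa using hv⟩ (T.continuous.norm.continuousOn)
    have hx1 : ‖x‖ = 1 := by simpa using hx
    refine lt_of_le_of_lt ?_ (hx1 ▸ h x (norm_ne_zero_iff.1 (by simp [hx1])))
    refine T.opNorm_le_bound (norm_nonneg _) fun y => ?_
    by_cases hy : y = 0
    · simp [hy]
    have hy' : ‖y‖ ≠ 0 := norm_ne_zero_iff.2 hy
    have := hmax (a := ((‖y‖ : ℂ)⁻¹) • y) (by simp [norm_smul, hy'])
    simp only [Set.mem_ofPred_eq, map_smul, norm_smul, norm_inv, Complex.norm_real,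
      norm_norm] at this
    rwa [inv_mul_le_iff₀ (by positivity), mul_comm] at this

end Schwarz

/-- The transpose of the row operator attached to a tuple of matrices. -/
noncomputable def rowMap (d n : ℕ) : MatTuple d n →L[ℂ]
    (EuclideanSpace ℂ (Fin n) →L[ℂ] EuclideanSpace ℂ (Fin d × Fin n)) :=
  LinearMap.toContinuousLinearMap
    { toFun := fun X => LinearMap.toContinuousLinearMap
        (Matrix.toEuclideanLin (Matrix.of fun (p : Fin d × Fin n) b => X p.1 b p.2))
      map_add' := fun X Y => by
        rw [← map_add, ← map_add]; rfl
      map_smul' := fun c X => by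
        rw [RingHom.id_apply, ← map_smul, ← map_smul]; rfl }

theorem rowMap_apply {d n : ℕ} (X : MatTuple d n) (x : EuclideanSpace ℂ (Fin n))
    (p : Fin d × Fin n) : rowMap d n X x p = ∑ b, X p.1 b p.2 * x b := rfl

theorem rowMap_injective (d n : ℕ) : Function.Injective (rowMap d n) := by
  intro X Y h
  ext j a b
  have := congrArg (fun T => T (EuclideanSpace.single a 1) (j, b)) h
  simpa [rowMap_apply] using this

theorem mem_freeBall_iff {d n : ℕ} (X : MatTuple d n) :
    X ∈ freeBall d n ↔ ‖rowMap d n X‖ < 1 := by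
  have hherm : (1 - ∑ j, X j * (X j)ᴴ).IsHermitian := by
    simp [Matrix.IsHermitian, Matrix.conjTranspose_sum]
  have hquad (x : Fin n → ℂ) : star x ⬝ᵥ ((1 - ∑ j, X j * (X j)ᴴ) *ᵥ x) =
      ((‖WithLp.toLp 2 (star x)‖ ^ 2 - ‖rowMap d n X (WithLp.toLp 2 (star x))‖ ^ 2 : ℝ) : ℂ) := by
    have h1 : star x ⬝ᵥ x = ((‖WithLp.toLp 2 (star x)‖ ^ 2 : ℝ) : ℂ) := by
      rw [EuclideanSpace.norm_sq_eq]
      simp [dotProduct, Complex.conj_mul']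
    have h2 (j : Fin d) : star x ⬝ᵥ ((X j * (X j)ᴴ) *ᵥ x) =
        ((∑ a, ‖rowMap d n X (WithLp.toLp 2 (star x)) (j, a)‖ ^ 2 : ℝ) : ℂ) := by
      rw [← Matrix.mulVec_mulVec, Matrix.dotProduct_mulVec, dotProduct]
      push_cast
      refine Finset.sum_congr rfl fun a _ => ?_
      rw [← Complex.mul_conj', rowMap_apply]
      simp only [vecMul, mulVec, dotProduct, map_sum, map_mul, Pi.star_apply,
        conjTranspose_apply, RCLike.star_def, Complex.conj_conj]
      simp only [mul_comm]
    rw [Matrix.sub_mulVec, dotProduct_sub, Matrix.one_mulVec, h1, Matrix.sum_mulVec,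
      dotProduct_sum, EuclideanSpace.norm_sq_eq (rowMap d n X _), Fintype.sum_prod_type]
    push_cast [h2]
    rfl
  rw [ContinuousLinearMap.norm_lt_one_iff_forall, freeBall, Set.mem_ofPred_eq,
    Matrix.posDef_iff_dotProduct_mulVec, and_iff_right hherm]
  constructor
  · intro h x hx
    have := h (x := star (WithLp.ofLp x)) (by simpa using hx)
    rw [hquad, Complex.zero_lt_real, star_star, WithLp.toLp_ofLp] at this
    exact lt_of_pow_lt_pow_left₀ 2 (norm_nonneg _) (by linarith)
  · intro h x hx
    rw [hquad, Complex.zero_lt_real]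
    have := h (WithLp.toLp 2 (star x)) (by simpa using hx)
    linarith [pow_lt_pow_left₀ this (norm_nonneg _) two_ne_zero]

theorem freeBall_eq (d n : ℕ) : freeBall d n = {X | ‖rowMap d n X‖ < 1} :=
  Set.ext mem_freeBall_iff

theorem zero_mem_freeBall (d n : ℕ) : (0 : MatTuple d n) ∈ freeBall d n := by
  simp [freeBall_eq]

theorem freeBall_mem_nhds (d n : ℕ) : freeBall d n ∈ nhds (0 : MatTuple d n) :=
  (isOpen_freeBall d n).mem_nhds (zero_mem_freeBall d n)

/-- The identification of level-one tuples with vectors. -/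
noncomputable def levelOneMap (d : ℕ) : MatTuple d 1 →L[ℂ] EuclideanSpace ℂ (Fin d) :=
  LinearMap.toContinuousLinearMap
    { toFun := fun X => WithLp.toLp 2 fun j => X j 0 0
      map_add' := fun _ _ => rfl
      map_smul' := fun _ _ => rfl }

theorem levelOneMap_apply {d : ℕ} (X : MatTuple d 1) (j : Fin d) :
    levelOneMap d X j = X j 0 0 := rfl

theorem levelOneMap_injective (d : ℕ) : Function.Injective (levelOneMap d) := by
  intro X Y h
  ext j a b
  rw [Subsingleton.elim a 0, Subsingleton.elim b 0]
  simpa [levelOneMap_apply] using congrArg (fun v => v j) h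

theorem freeBall_one_eq (d : ℕ) : freeBall d 1 = {X | ‖levelOneMap d X‖ < 1} := by
  ext X
  have hdiag : (1 - ∑ j, X j * (X j)ᴴ) =
      Matrix.diagonal fun _ => ((1 - ‖levelOneMap d X‖ ^ 2 : ℝ) : ℂ) := by
    ext a b
    rw [Subsingleton.elim a 0, Subsingleton.elim b 0, EuclideanSpace.norm_sq_eq]
    simp [Matrix.sum_apply, Matrix.mul_apply, Complex.mul_conj', levelOneMap_apply]
  rw [freeBall, Set.mem_ofPred_eq, hdiag, Matrix.posDef_diagonal_iff, Set.mem_ofPred_eq]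
  simp only [Complex.zero_lt_real, forall_const, sub_pos]
  exact sq_lt_one_iff₀ (norm_nonneg _)

/-- The elementary tensor of a vector and a matrix, as a tuple. -/
def vecTensor {d n : ℕ} (v : MatTuple d 1) (A : Matrix (Fin n) (Fin n) ℂ) : MatTuple d n :=
  fun j => v j 0 0 • A

theorem dSum_zero_right {d m : ℕ} (v : MatTuple d 1) :
    dSum v (0 : MatTuple d m) =
      vecTensor v (Matrix.single (Fin.castAdd m 0) (Fin.castAdd m 0) 1) := by
  funext j
  ext a b
  refine Fin.addCases (fun a => ?_) (fun a => ?_) a <;>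
  refine Fin.addCases (fun b => ?_) (fun b => ?_) b
  · rw [Subsingleton.elim a 0, Subsingleton.elim b 0]
    simp [dSum, vecTensor]
  all_goals
    have hne (c : Fin m) : Fin.castAdd m (0 : Fin 1) ≠ Fin.natAdd 1 c := by
      simp [Fin.ext_iff]; omega
    simp [dSum, vecTensor, hne]

namespace NCSelfMap

variable {d : ℕ} (f : NCSelfMap d)

theorem hasFDerivAt_zero (n : ℕ) :
    HasFDerivAt (f.app n) (fderiv ℂ (f.app n) 0) 0 :=
  ((f.holo n).differentiableAt (freeBall_mem_nhds d n)).hasFDerivAt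

theorem app_zero (h1 : f.app 1 0 = 0) (n : ℕ) : f.app n 0 = 0 := by
  have hsum (n m : ℕ) : dSum (0 : MatTuple d n) (0 : MatTuple d m) = 0 := by
    funext j
    simp [dSum]
  induction n with
  | zero => exact Subsingleton.elim _ _
  | succ n ih =>
    have := f.map_dSum (0 : MatTuple d n) (0 : MatTuple d 1)
      (zero_mem_freeBall d n) (zero_mem_freeBall d 1)
    rwa [ih, h1, hsum] at this

theorem fderiv_conj {n : ℕ} (S : Matrix (Fin n) (Fin n) ℂ) (hS : IsUnit S) (W : MatTuple d n) :
    fderiv ℂ (f.app n) 0 (fun j => S⁻¹ * W j * S) =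
      fun j => S⁻¹ * fderiv ℂ (f.app n) 0 W j * S := by
  let A : MatTuple d n →L[ℂ] MatTuple d n := LinearMap.toContinuousLinearMap
    { toFun := fun W j => S⁻¹ * W j * S
      map_add' := fun _ _ => by funext j; simp [mul_add, add_mul]
      map_smul' := fun _ _ => by funext j; simp }
  have hA : A ⁻¹' freeBall d n ∈ nhds (0 : MatTuple d n) :=
    A.continuous.continuousAt.preimage_mem_nhds (by simpa using freeBall_mem_nhds d n)
  refine (f.hasFDerivAt_zero n).intertwine A (f.hasFDerivAt_zero n) ?_ W
  filter_upwards [hA, freeBall_mem_nhds d n] with X hX hX'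
  exact f.map_sim X S hX' hS hX

theorem fderiv_dSum_zero {m : ℕ} (h1 : f.app 1 0 = 0) (v : MatTuple d 1) :
    fderiv ℂ (f.app (1 + m)) 0 (dSum v 0) = dSum (fderiv ℂ (f.app 1) 0 v) 0 := by
  let A : MatTuple d 1 →L[ℂ] MatTuple d (1 + m) := LinearMap.toContinuousLinearMap
    { toFun := fun v => dSum v 0
      map_add' := fun _ _ => by
        simp only [dSum_zero_right]; funext j; simp [vecTensor, add_smul, -smul_single]
      map_smul' := fun _ _ => by
        simp only [dSum_zero_right]; funext j; simp [vecTensor, smul_smul, -smul_single] }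
  refine (f.hasFDerivAt_zero 1).intertwine A (f.hasFDerivAt_zero (1 + m)) ?_ v
  filter_upwards [freeBall_mem_nhds d 1] with X hX
  have := f.map_dSum X (0 : MatTuple d m) hX (zero_mem_freeBall d m)
  rwa [f.app_zero h1 m] at this

/-- The matrices `A` for which the derivative at `0` acts on `v ⊗ A` through the first factor. -/
noncomputable def tensorSubmodule (n : ℕ) : Submodule ℂ (Matrix (Fin n) (Fin n) ℂ) where
  carrier := {A | ∀ v, fderiv ℂ (f.app n) 0 (vecTensor v A) =
    vecTensor (fderiv ℂ (f.app 1) 0 v) A}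
  zero_mem' := fun v => by
    have (v : MatTuple d 1) : vecTensor v (0 : Matrix (Fin n) (Fin n) ℂ) = 0 := by
      funext j; simp [vecTensor]
    simp [this]
  add_mem' := fun {A B} hA hB v => by
    have (v : MatTuple d 1) : vecTensor v (A + B) = vecTensor v A + vecTensor v B := by
      funext j; simp [vecTensor]
    simp only [Set.mem_ofPred_eq] at hA hB
    rw [this, map_add, hA, hB, this]
  smul_mem' := fun c A hA v => by
    have (v : MatTuple d 1) : vecTensor v (c • A) = c • vecTensor v A := by
      funext j; simp [vecTensor, smul_comm c]
    simp only [Set.mem_ofPred_eq] at hA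
    rw [this, map_smul, hA, this]

theorem conj_mem_tensorSubmodule {n : ℕ} {A S S' : Matrix (Fin n) (Fin n) ℂ} (hS : S' * S = 1)
    (hA : A ∈ f.tensorSubmodule n) : S' * A * S ∈ f.tensorSubmodule n := by
  intro v
  rw [← Matrix.inv_eq_left_inv hS]
  have hv (v : MatTuple d 1) : vecTensor v (S⁻¹ * A * S) =
      fun j => S⁻¹ * vecTensor v A j * S := by
    funext j; simp [vecTensor]
  rw [hv, f.fderiv_conj S (IsUnit.of_mul_eq_one_right S' hS), hA v, hv]

theorem tensorSubmodule_eq_top {m : ℕ} (h1 : f.app 1 0 = 0) :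
    f.tensorSubmodule (1 + m) = ⊤ := by
  set P := f.tensorSubmodule (1 + m)
  set e : Fin (1 + m) := Fin.castAdd m 0
  have hee : Matrix.single e e 1 ∈ P := by
    intro v
    rw [← dSum_zero_right, ← dSum_zero_right, f.fderiv_dSum_zero h1]
  have hmul {i j k l : Fin (1 + m)} (h : j ≠ k) :
      Matrix.single i j (1 : ℂ) * Matrix.single k l 1 = 0 :=
    Matrix.single_mul_single_of_ne _ _ _ _ h _
  have hconj {a b : Fin (1 + m)} (hab : a ≠ b) {A : Matrix _ _ ℂ} (hA : A ∈ P) :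
      (1 - Matrix.single a b 1) * A * (1 + Matrix.single a b 1) ∈ P := by
    refine f.conj_mem_tensorSubmodule ?_ hA
    simp [sub_mul, mul_add, hmul hab.symm]
  have hcol (a : Fin (1 + m)) : Matrix.single a e 1 ∈ P := by
    by_cases ha : a = e
    · rwa [ha]
    have := P.sub_mem hee (hconj ha hee)
    simpa [sub_mul, mul_add, hmul (Ne.symm ha)] using this
  have hrow (b : Fin (1 + m)) : Matrix.single e b 1 ∈ P := by
    by_cases hb : b = e
    · rwa [hb]
    have := P.sub_mem (hconj (Ne.symm hb) hee) hee
    simpa [sub_mul, mul_add, hmul hb] using this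
  have hall (a b : Fin (1 + m)) : Matrix.single a b 1 ∈ P := by
    by_cases ha : a = e
    · rw [ha]; exact hrow b
    have := P.sub_mem (hrow b) (hconj ha (hrow b))
    by_cases hab : b = a
    · subst hab
      have h2 := P.add_mem this (P.sub_mem hee (hcol b))
      simp only [sub_mul, mul_add, one_mul, mul_one, Matrix.single_mul_single_same] at h2
      convert h2 using 1
      abel
    · simpa [sub_mul, mul_add, hmul hab, hmul (Ne.symm ha)] using this
  rw [eq_top_iff]
  intro A _
  rw [Matrix.matrix_eq_sum_single A]
  refine P.sum_mem fun a _ => P.sum_mem fun b _ => ?_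
  simpa [Matrix.smul_single] using P.smul_mem (A a b) (hall a b)

theorem fderiv_apply_entry {m : ℕ} (h1 : f.app 1 0 = 0) (W : MatTuple d (1 + m))
    (a b : Fin (1 + m)) :
    (fun j => Matrix.of fun _ _ => fderiv ℂ (f.app (1 + m)) 0 W j a b) =
      fderiv ℂ (f.app 1) 0 (fun j => Matrix.of fun _ _ => W j a b) := by
  have hW : W = ∑ p, ∑ q, vecTensor (fun j => Matrix.of fun _ _ => W j p q)
      (Matrix.single p q 1) := by
    funext j
    conv_lhs => rw [Matrix.matrix_eq_sum_single (W j)]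
    simp [vecTensor, Finset.sum_apply, Matrix.smul_single]
  have hT (v : MatTuple d 1) (p q : Fin (1 + m)) :
      fderiv ℂ (f.app (1 + m)) 0 (vecTensor v (Matrix.single p q 1)) =
        vecTensor (fderiv ℂ (f.app 1) 0 v) (Matrix.single p q 1) :=
    (f.tensorSubmodule_eq_top h1 ▸ Submodule.mem_top :
      Matrix.single p q 1 ∈ f.tensorSubmodule (1 + m)) v
  funext j
  ext c c'
  rw [Subsingleton.elim c 0, Subsingleton.elim c' 0]
  conv_lhs => rw [hW]
  simp only [map_sum, hT]
  simp [vecTensor, Finset.sum_apply, Matrix.sum_apply, Matrix.single_apply, ite_and]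

end NCSelfMap

/-- if the only level-1 fixed point of an nc self-map is the origin, then
the only fixed point on every level is the zero tuple. -/
theorem stmt_15 {d : ℕ} (f : NCSelfMap d)
    (hfix1 : ∀ v ∈ freeBall d 1, (f.app 1 v = v ↔ v = 0)) :
    ∀ n : ℕ, 1 ≤ n → ∀ X ∈ freeBall d n, (f.app n X = X ↔ X = 0) := by
  have h1 : f.app 1 0 = 0 := (hfix1 0 (zero_mem_freeBall d 1)).2 rfl
  intro n hn X hX
  refine ⟨fun hfX => ?_, fun h => h ▸ f.app_zero h1 n⟩
  by_contra hX0
  obtain ⟨m, rfl⟩ := Nat.exists_eq_add_of_le hn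
  have hf := f.holo (1 + m)
  have hm := f.mapsTo (1 + m)
  rw [freeBall_eq] at hf hm hX
  obtain ⟨W, hW0, hW⟩ := exists_fixed_vector_of_fixed_point (rowMap d (1 + m))
    (rowMap_injective d (1 + m)) hf hm (f.app_zero h1 _) (f.hasFDerivAt_zero _) hX hX0 hfX
  obtain ⟨j, a, b, hab⟩ : ∃ j a b, W j a b ≠ 0 := by
    by_contra! h
    exact hW0 (by ext j a b; exact h j a b)
  have hw := f.fderiv_apply_entry h1 W a b
  rw [show fderiv ℂ (f.app (1 + m)) 0 W = W from hW] at hw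
  have hf' := f.holo 1
  have hm' := f.mapsTo 1
  rw [freeBall_one_eq] at hf' hm'
  obtain ⟨x, hx, hx0, hfx⟩ := exists_fixed_point_of_fixed_vector (levelOneMap d)
    (levelOneMap_injective d) hf' hm' h1 (f.hasFDerivAt_zero 1)
    (fun h => hab (congrFun (congrFun (congrFun h j) 0) 0)) hw.symm
  exact hx0 ((hfix1 x (by rwa [freeBall_one_eq])).1 hfx)
end
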